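/- Let n ≥ 1, p ∈ ℕ, c > 0. The dimension of the first-order polynomial Trefftz space is dim 𝕋^p = (n+1)·C(p+n, n), where C(a,b) denotes the binomial coefficient. -/

import Mathlib

open MvPolynomial

/-- Pairs `(w, τ)` of a scalar and a (space-)vector valued real polynomial in the `n` space
variables (indexed by `Sum.inl`) and the time variable (`Sum.inr ()`). -/
abbrev STPair (n : ℕ) :=
  MvPolynomial (Fin n ⊕ Unit) ℝ × (Fin n → MvPolynomial (Fin n ⊕ Unit) ℝ)

/-- The first equation of the first-order acoustic system: `(w,τ) ↦ ∇·τ + c⁻² ∂ₜw`. -/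
noncomputable def acousticDiv (n : ℕ) (c : ℝ) :
    STPair n →ₗ[ℝ] MvPolynomial (Fin n ⊕ Unit) ℝ :=
  (∑ m : Fin n, (pderiv (Sum.inl m)).toLinearMap ∘ₗ
      (LinearMap.proj m ∘ₗ LinearMap.snd ℝ _ _))
    + (c ^ 2)⁻¹ • ((pderiv (Sum.inr ())).toLinearMap ∘ₗ LinearMap.fst ℝ _ _)

/-- The second equation of the first-order acoustic system: `(w,τ) ↦ ∇w + ∂ₜτ`. -/
noncomputable def acousticGrad (n : ℕ) :
    STPair n →ₗ[ℝ] (Fin n → MvPolynomial (Fin n ⊕ Unit) ℝ) :=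
  LinearMap.pi fun m =>
    ((pderiv (Sum.inl m)).toLinearMap ∘ₗ LinearMap.fst ℝ _ _)
      + ((pderiv (Sum.inr ())).toLinearMap ∘ₗ (LinearMap.proj m ∘ₗ LinearMap.snd ℝ _ _))

/-- Pairs `(w,τ)` all of whose components have total degree `≤ p`,
i.e. the space `ℙ^p(ℝ^{n+1})^{1+n}`. -/
noncomputable def degLE (n p : ℕ) : Submodule ℝ (STPair n) :=
  Submodule.comap (LinearMap.fst ℝ _ _) (restrictTotalDegree (Fin n ⊕ Unit) ℝ p)
    ⊓ ⨅ m : Fin n, Submodule.comap (LinearMap.proj m ∘ₗ LinearMap.snd ℝ _ _)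
        (restrictTotalDegree (Fin n ⊕ Unit) ℝ p)

/-- The first-order polynomial Trefftz space
`𝕋^p = {(w,τ) ∈ ℙ^p(ℝ^{n+1})^{1+n} : ∇·τ + c⁻²∂ₜw = 0, ∇w + ∂ₜτ = 0}`. -/
noncomputable def trefftzT (n p : ℕ) (c : ℝ) : Submodule ℝ (STPair n) :=
  degLE n p ⊓ LinearMap.ker (acousticDiv n c) ⊓ LinearMap.ker (acousticGrad n)

namespace MvPolynomial

variable {σ R : Type*}

theorem pderiv_mem_restrictSupport [CommSemiring R] {s t : Set (σ →₀ ℕ)} (i : σ)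
    (h : ∀ d ∈ s, d i ≠ 0 → d - Finsupp.single i 1 ∈ t) {f : MvPolynomial σ R}
    (hf : f ∈ restrictSupport R s) : pderiv i f ∈ restrictSupport R t := by
  rw [restrictSupport_eq_span] at hf
  induction hf using Submodule.span_induction with
  | mem x hx =>
    obtain ⟨d, hd, rfl⟩ := hx
    rw [pderiv_monomial, monomial_mem_restrictSupport]
    by_cases hi : d i = 0
    · simp [hi]
    · exact Or.inl (h d hd hi)
  | zero => simp
  | add x y _ _ hx hy => simpa using add_mem hx hy
  | smul a x _ hx => simpa using Submodule.smul_mem _ a hx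

theorem exists_pderiv_eq {K : Type*} [Field K] [CharZero K] {s t : Set (σ →₀ ℕ)} (i : σ)
    (h : ∀ d ∈ s, d + Finsupp.single i 1 ∈ t) {f : MvPolynomial σ K}
    (hf : f ∈ restrictSupport K s) : ∃ g ∈ restrictSupport K t, pderiv i g = f := by
  rw [restrictSupport_eq_span] at hf
  induction hf using Submodule.span_induction with
  | mem x hx =>
    obtain ⟨d, hd, rfl⟩ := hx
    refine ⟨monomial (d + Finsupp.single i 1) ((d i + 1 : K)⁻¹), ?_, ?_⟩
    · exact (monomial_mem_restrictSupport _).2 (Or.inl (h d hd))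
    · have : (d i + 1 : K) ≠ 0 := by exact_mod_cast Nat.succ_ne_zero (d i)
      simp [pderiv_monomial, this]
  | zero => exact ⟨0, zero_mem _, map_zero _⟩
  | add x y _ _ hx hy =>
    obtain ⟨u, hu, rfl⟩ := hx
    obtain ⟨v, hv, rfl⟩ := hy
    exact ⟨u + v, add_mem hu hv, map_add _ _ _⟩
  | smul a x _ hx =>
    obtain ⟨u, hu, rfl⟩ := hx
    exact ⟨a • u, Submodule.smul_mem _ a hu, Derivation.map_smul _ _ _⟩

theorem finrank_restrictSupport {K : Type*} [Field K] (s : Set (σ →₀ ℕ)) :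
    Module.finrank K (restrictSupport K s) = s.ncard :=
  Module.finrank_eq_nat_card_basis (basisRestrictSupport K s)

end MvPolynomial

namespace Finsupp

variable {σ : Type*} [Fintype σ]

theorem ncard_degree_eq (p : ℕ) :
    {d : σ →₀ ℕ | d.degree = p}.ncard = (Fintype.card σ + p - 1).choose p := by
  classical
  rw [← Sym.card_sym_eq_choose, ← Nat.card_eq_fintype_card, Nat.card_congr (Sym.equivNatSum σ p)]
  rfl

theorem ncard_degree_le (p : ℕ) :
    {d : σ →₀ ℕ | d.degree ≤ p}.ncard
      = {d : σ →₀ ℕ | d.degree < p}.ncard + (Fintype.card σ + p - 1).choose p := by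
  rw [← ncard_degree_eq, ← Set.ncard_union_eq ?_ (finite_of_degree_lt p) (finite_of_degree_eq p)]
  · congr 1
    ext d
    exact le_iff_lt_or_eq (a := d.degree)
  · exact Set.disjoint_left.2 fun _ h h' => (ne_of_lt h) h'

end Finsupp

/-- Pairs `(w, τ)` all of whose components are supported on the exponents in `s`. -/
noncomputable def supportedPairs (n : ℕ) (s : Set (Fin n ⊕ Unit →₀ ℕ)) :
    Submodule ℝ (STPair n) :=
  (restrictSupport ℝ s).prod (Submodule.pi Set.univ fun _ => restrictSupport ℝ s)

theorem mem_supportedPairs {n : ℕ} {s : Set (Fin n ⊕ Unit →₀ ℕ)} {u : STPair n} :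
    u ∈ supportedPairs n s ↔ u.1 ∈ restrictSupport ℝ s ∧ ∀ m, u.2 m ∈ restrictSupport ℝ s := by
  simp [supportedPairs, Submodule.mem_prod, Submodule.mem_pi]

theorem degLE_eq_supportedPairs (n p : ℕ) :
    degLE n p = supportedPairs n {d | d.degree ≤ p} := by
  ext u
  simp only [degLE, Submodule.mem_inf, Submodule.mem_iInf, mem_supportedPairs]
  rfl

theorem finite_supportedPairs {n : ℕ} {s : Set (Fin n ⊕ Unit →₀ ℕ)} (hs : s.Finite) :
    Module.Finite ℝ (supportedPairs n s) ∧
      Module.finrank ℝ (supportedPairs n s) = (n + 1) * s.ncard := by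
  have := hs.to_subtype
  have : Module.Finite ℝ (restrictSupport ℝ s) := .of_basis (basisRestrictSupport ℝ s)
  let e : (restrictSupport ℝ s × (Fin n → restrictSupport ℝ s)) ≃ₗ[ℝ] supportedPairs n s :=
    { toFun := fun v => ⟨(v.1, fun m => v.2 m),
        mem_supportedPairs.2 ⟨v.1.2, fun m => (v.2 m).2⟩⟩
      invFun := fun u => (⟨u.1.1, (mem_supportedPairs.1 u.2).1⟩,
        fun m => ⟨u.1.2 m, (mem_supportedPairs.1 u.2).2 m⟩)
      map_add' := fun _ _ => rfl
      map_smul' := fun _ _ => rfl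
      left_inv := fun _ => rfl
      right_inv := fun _ => rfl }
  refine ⟨.equiv e, ?_⟩
  rw [← e.finrank_eq, Module.finrank_prod, Module.finrank_pi_fintype]
  simp only [finrank_restrictSupport, Finset.sum_const, Finset.card_univ, Fintype.card_fin,
    smul_eq_mul]
  ring

/-- The first-order acoustic operator `(w,τ) ↦ (∇·τ + c⁻² ∂ₜw, ∇w + ∂ₜτ)`. -/
noncomputable def acoustic (n : ℕ) (c : ℝ) : STPair n →ₗ[ℝ] STPair n :=
  (acousticDiv n c).prod (acousticGrad n)

theorem acoustic_apply (n : ℕ) (c : ℝ) (u : STPair n) :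
    acoustic n c u = (∑ m, pderiv (Sum.inl m) (u.2 m) + (c ^ 2)⁻¹ • pderiv (Sum.inr ()) u.1,
      fun m => pderiv (Sum.inl m) u.1 + pderiv (Sum.inr ()) (u.2 m)) := by
  refine Prod.ext ?_ ?_
  · simp [acoustic, acousticDiv]
  · ext1 m
    simp [acoustic, acousticGrad]

theorem trefftzT_eq (n p : ℕ) (c : ℝ) :
    trefftzT n p c = supportedPairs n {d | d.degree ≤ p} ⊓ LinearMap.ker (acoustic n c) := by
  rw [trefftzT, degLE_eq_supportedPairs, acoustic, LinearMap.ker_prod, inf_assoc]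

theorem Finsupp.degree_sub_single {σ : Type*} (d : σ →₀ ℕ) (i : σ) (hi : d i ≠ 0) :
    (d - Finsupp.single i 1).degree + 1 = d.degree := by
  have h : d - Finsupp.single i 1 + Finsupp.single i 1 = d :=
    tsub_add_cancel_of_le (by simpa [Nat.one_le_iff_ne_zero] using hi)
  conv_rhs => rw [← h]
  simp

theorem acoustic_mem {n p : ℕ} (c : ℝ) {u : STPair n}
    (hu : u ∈ supportedPairs n {d | d.degree ≤ p}) :
    acoustic n c u ∈ supportedPairs n {d | d.degree < p} := by
  rw [mem_supportedPairs] at hu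
  have key (i : Fin n ⊕ Unit) {f : MvPolynomial (Fin n ⊕ Unit) ℝ}
      (hf : f ∈ restrictSupport ℝ {d | d.degree ≤ p}) :
      pderiv i f ∈ restrictSupport ℝ {d | d.degree < p} := by
    refine pderiv_mem_restrictSupport i (fun d (hd : d.degree ≤ p) hi => ?_) hf
    have := Finsupp.degree_sub_single d i hi
    change (d - Finsupp.single i 1).degree < p
    omega
  rw [acoustic_apply, mem_supportedPairs]
  exact ⟨add_mem (sum_mem fun m _ => key _ (hu.2 m)) (Submodule.smul_mem _ _ (key _ hu.1)),
    fun m => add_mem (key _ hu.1) (key _ (hu.2 m))⟩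

theorem exists_acoustic_eq {n p : ℕ} {c : ℝ} (hc : c ≠ 0) (k : ℕ) :
    ∀ v ∈ supportedPairs n {d | d.degree < p ∧ ∑ i, d (Sum.inl i) < k},
      ∃ u ∈ supportedPairs n {d | d.degree ≤ p}, acoustic n c u = v := by
  induction k with
  | zero =>
    intro v hv
    refine ⟨0, zero_mem _, ?_⟩
    rw [mem_supportedPairs] at hv
    simp only [mem_restrictSupport_iff, not_lt_zero, and_false, Set.ofPred_false,
      Set.subset_empty_iff, Finset.coe_eq_empty, support_eq_empty] at hv
    rw [map_zero]
    exact Prod.ext hv.1.symm (funext fun m => (hv.2 m).symm)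
  | succ k ih =>
    intro v hv
    rw [mem_supportedPairs] at hv
    let t : Set (Fin n ⊕ Unit →₀ ℕ) := {d | d.degree ≤ p ∧ ∑ i, d (Sum.inl i) < k + 1}
    have anti {f : MvPolynomial (Fin n ⊕ Unit) ℝ}
        (hf : f ∈ restrictSupport ℝ {d | d.degree < p ∧ ∑ i, d (Sum.inl i) < k + 1}) :
        ∃ g ∈ restrictSupport ℝ t, pderiv (Sum.inr ()) g = f := by
      refine exists_pderiv_eq _ (fun d hd => ?_) hf
      exact ⟨by simpa using hd.1, by simpa using hd.2⟩
    have space (m : Fin n) {g : MvPolynomial (Fin n ⊕ Unit) ℝ} (hg : g ∈ restrictSupport ℝ t) :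
        pderiv (Sum.inl m) g ∈
          restrictSupport ℝ {d | d.degree < p ∧ ∑ i, d (Sum.inl i) < k} := by
      refine pderiv_mem_restrictSupport _ (fun d hd hi => ?_) hg
      constructor
      · have := Finsupp.degree_sub_single d _ hi
        have := hd.1
        omega
      · refine lt_of_lt_of_le (Finset.sum_lt_sum (g := fun i => d (Sum.inl i))
          (fun i _ => ?_) ⟨m, Finset.mem_univ m, ?_⟩) (Nat.lt_succ_iff.1 hd.2)
        · simp
        · simpa using Nat.pos_of_ne_zero hi
    have ht : t ⊆ {d | d.degree ≤ p} := fun _ hd => hd.1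
    obtain ⟨w, hw, hwv⟩ := anti hv.1
    choose τ hτ hτv using fun m => anti (hv.2 m)
    obtain ⟨u, hu, huv⟩ := ih (-∑ m, pderiv (Sum.inl m) (τ m),
        fun m => -(c ^ 2 • pderiv (Sum.inl m) w)) <| mem_supportedPairs.2
      ⟨neg_mem (sum_mem fun m _ => space m (hτ m)),
        fun m => neg_mem (Submodule.smul_mem _ _ (space m hw))⟩
    refine ⟨(c ^ 2 • w, τ) + u, add_mem (mem_supportedPairs.2
      ⟨Submodule.smul_mem _ _ (restrictSupport_mono _ ht hw),
        fun m => restrictSupport_mono _ ht (hτ m)⟩) hu, ?_⟩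
    rw [map_add, huv, acoustic_apply]
    refine Prod.ext ?_ (funext fun m => ?_)
    · simp [hwv, smul_smul, hc]
    · simp [hτv]

theorem map_acoustic (n p : ℕ) {c : ℝ} (hc : c ≠ 0) :
    (supportedPairs n {d | d.degree ≤ p}).map (acoustic n c)
      = supportedPairs n {d | d.degree < p} := by
  refine le_antisymm (Submodule.map_le_iff_le_comap.2 fun u hu => acoustic_mem c hu) fun v hv => ?_
  refine exists_acoustic_eq hc p v ?_
  convert hv using 3
  ext d
  refine and_iff_left_of_imp fun hd => lt_of_le_of_lt ?_ hd
  simp [Finsupp.degree_eq_sum]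

/-- The dimension of the first-order polynomial Trefftz space:
`dim 𝕋^p = (n+1)·C(p+n, n)`. -/
theorem trefftzT_finrank (n p : ℕ) (hn : 1 ≤ n) (c : ℝ) (hc : 0 < c) :
    Module.finrank ℝ (trefftzT n p c) = (n + 1) * (p + n).choose n := by
  obtain ⟨hfin, hle⟩ := finite_supportedPairs (Finsupp.finite_of_degree_le (σ := Fin n ⊕ Unit) p)
  have hlt := (finite_supportedPairs (Finsupp.finite_of_degree_lt (σ := Fin n ⊕ Unit) p)).2
  have hrank := LinearMap.finrank_range_add_finrank_ker
    ((acoustic n c).domRestrict (supportedPairs n {d | d.degree ≤ p}))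
  rw [LinearMap.range_domRestrict, map_acoustic n p hc.ne', LinearMap.ker_domRestrict,
    hlt, hle, Finsupp.ncard_degree_le, mul_add] at hrank
  have hker := Submodule.finrank_map_subtype_eq (supportedPairs n {d | d.degree ≤ p})
    ((LinearMap.ker (acoustic n c)).submoduleOf (supportedPairs n {d | d.degree ≤ p}))
  rw [Submodule.submoduleOf, Submodule.map_comap_subtype, ← trefftzT_eq] at hker
  rw [hker]
  have hchoose : (Fintype.card (Fin n ⊕ Unit) + p - 1).choose p = (p + n).choose n := by
    rw [Fintype.card_sum, Fintype.card_fin, Fintype.card_unit,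
      show n + 1 + p - 1 = p + n by omega, Nat.choose_symm_add]
  rw [hchoose] at hrank
  exact Nat.add_left_cancel hrank
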